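/- (Secrecy gain of A₁₅⁺.) Let g = (1/4, …, 1/4, −3/4, −3/4, −3/4, −3/4) ∈ ℝ¹⁶ (twelve coordinates 1/4 and four coordinates −3/4), and let A₁₅⁺ ⊆ ℝ¹⁶ be the set of vectors x with ∑_i x_i = 0 such that x − k·g has all integer coordinates for some k ∈ {0, 1, 2, 3}. Then for every real y > 0, θ₃(y)¹⁵ / (∑_{x ∈ A₁₅⁺} e^{-π y ‖x‖²}) ≤ 32/17, with equality at y = 1; in particular the secrecy gain of A₁₅⁺ is 32/17 and is achieved at τ = i. -/

import Mathlib

open Real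

/-- θ₃ on the imaginary axis: θ₃(y) = ∑_{n ∈ ℤ} e^{-π y n²}. -/
noncomputable def theta3 (y : ℝ) : ℝ := ∑' n : ℤ, Real.exp (-π * y * (n : ℝ)^2)

/-- The glue vector g = ((1/4)¹², (−3/4)⁴) ∈ ℝ¹⁶. -/
noncomputable def glueA15 : Fin 16 → ℝ := fun i => if (i : ℕ) < 12 then 1/4 else -3/4

/-- The lattice A₁₅⁺ ⊆ ℝ¹⁶: vectors x with coordinate sum 0 such that x − k·g is
integral for some k ∈ {0, 1, 2, 3}. -/
def A15plus : Set (EuclideanSpace ℝ (Fin 16)) :=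
  {x | (∑ i, x i) = 0 ∧
    ∃ k : Fin 4, ∀ i, ∃ m : ℤ, x i - ((k : ℕ) : ℝ) * glueA15 i = (m : ℝ)}

/-- The summand of the theta function with characteristics `a`, `b` at `τ = iy`. -/
noncomputable def thetaCharTerm (a b y : ℝ) (n : ℤ) : ℂ :=
  Complex.exp (2 * π * b * n * Complex.I - π * y * (n + a) ^ 2)

/-- The theta function with characteristics `a`, `b` at `τ = iy`. -/
noncomputable def thetaChar (a b y : ℝ) : ℂ := ∑' n : ℤ, thetaCharTerm a b y n

lemma thetaCharTerm_eq_jacobiTheta₂_term (a b y : ℝ) (n : ℤ) :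
    thetaCharTerm a b y n = Complex.exp (-π * y * a ^ 2) *
      jacobiTheta₂_term n (b + Complex.I * y * a) (Complex.I * y) := by
  rw [thetaCharTerm, jacobiTheta₂_term, ← Complex.exp_add]
  congr 1
  linear_combination (-2 * π * n * y * a - π * n ^ 2 * y : ℂ) * Complex.I_sq

lemma summable_norm_thetaCharTerm (a b : ℝ) {y : ℝ} (hy : 0 < y) :
    Summable fun n => ‖thetaCharTerm a b y n‖ := by
  have h : Summable (jacobiTheta₂_term · (b + Complex.I * y * a) (Complex.I * y)) :=
    (summable_jacobiTheta₂_term_iff _ _).2 (by simpa using hy)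
  exact ((h.mul_left _).congr fun n => (thetaCharTerm_eq_jacobiTheta₂_term a b y n).symm).norm

lemma thetaChar_eq_jacobiTheta₂ (a b y : ℝ) :
    thetaChar a b y = Complex.exp (-π * y * a ^ 2) *
      jacobiTheta₂ (b + Complex.I * y * a) (Complex.I * y) := by
  simp_rw [thetaChar, thetaCharTerm_eq_jacobiTheta₂_term, tsum_mul_left, jacobiTheta₂]

lemma thetaChar_add_one_left (a b y : ℝ) :
    thetaChar (a + 1) b y = Complex.exp (-2 * π * b * Complex.I) * thetaChar a b y := by
  rw [thetaChar, thetaChar, ← (Equiv.subRight (1 : ℤ)).tsum_eq, ← tsum_mul_left]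
  refine tsum_congr fun n => ?_
  rw [thetaCharTerm, thetaCharTerm, ← Complex.exp_add]
  congr 1
  simp only [Equiv.subRight_apply]
  push_cast
  ring

lemma thetaChar_add_one_right (a b y : ℝ) : thetaChar a (b + 1) y = thetaChar a b y := by
  refine tsum_congr fun n => ?_
  rw [thetaCharTerm, thetaCharTerm, Complex.exp_eq_exp_iff_exists_int]
  exact ⟨n, by push_cast; ring⟩

lemma thetaChar_neg (a b y : ℝ) : thetaChar (-a) (-b) y = thetaChar a b y := by
  rw [thetaChar, thetaChar, ← (Equiv.neg ℤ).tsum_eq]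
  refine tsum_congr fun n => ?_
  rw [thetaCharTerm, thetaCharTerm]
  congr 1
  simp only [Equiv.neg_apply]
  push_cast
  ring

lemma conj_thetaChar (a b y : ℝ) :
    (starRingEnd ℂ) (thetaChar a b y) = thetaChar a (-b) y := by
  rw [thetaChar, thetaChar, Complex.conj_tsum]
  refine tsum_congr fun n => ?_
  rw [thetaCharTerm, thetaCharTerm, ← Complex.exp_conj]
  congr 1
  simp [map_ofNat]

/-- The coordinates `(s, d)` for pairs `(m, n)` of integers: `m = s + d`, `n = s - d` when `m + n` is
even, and `m = s + d + 1`, `n = s - d` when it is odd. -/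
noncomputable def rotatePairsEquiv : (ℤ × ℤ) ⊕ (ℤ × ℤ) ≃ ℤ × ℤ :=
  Equiv.ofBijective
    (Sum.elim (fun p => (p.1 + p.2, p.1 - p.2)) fun p => (p.1 + p.2 + 1, p.1 - p.2)) <| by
    constructor
    · rintro (⟨a, b⟩ | ⟨a, b⟩) (⟨c, d⟩ | ⟨c, d⟩) h <;>
        simp only [Sum.elim_inl, Sum.elim_inr, Prod.mk.injEq, Sum.inl.injEq, Sum.inr.injEq,
          reduceCtorEq] at h ⊢ <;> omega
    · rintro ⟨m, n⟩
      obtain h | h := Int.emod_two_eq_zero_or_one (m + n)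
      · exact ⟨Sum.inl ((m + n) / 2, (m - n) / 2),
          by simp only [Sum.elim_inl, Prod.mk.injEq]; omega⟩
      · exact ⟨Sum.inr ((m + n - 1) / 2, (m - n - 1) / 2),
          by simp only [Sum.elim_inr, Prod.mk.injEq]; omega⟩

lemma rotatePairsEquiv_inl (p : ℤ × ℤ) :
    rotatePairsEquiv (Sum.inl p) = (p.1 + p.2, p.1 - p.2) := rfl

lemma rotatePairsEquiv_inr (p : ℤ × ℤ) :
    rotatePairsEquiv (Sum.inr p) = (p.1 + p.2 + 1, p.1 - p.2) := rfl

/-- The product formula for theta functions with characteristics. -/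
lemma thetaChar_mul_thetaChar (a b a' b' : ℝ) {y : ℝ} (hy : 0 < y) :
    thetaChar a b y * thetaChar a' b' y =
      thetaChar ((a + a') / 2) (b + b') (2 * y) * thetaChar ((a - a') / 2) (b - b') (2 * y) +
      Complex.exp (2 * π * b * Complex.I) *
        (thetaChar ((a + a') / 2 + 1 / 2) (b + b') (2 * y) *
          thetaChar ((a - a') / 2 + 1 / 2) (b - b') (2 * y)) := by
  have hy2 : 0 < 2 * y := by positivity
  have hs := summable_mul_of_summable_norm (summable_norm_thetaCharTerm a b hy)
    (summable_norm_thetaCharTerm a' b' hy)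
  have key := ((rotatePairsEquiv.summable_iff).2 hs)
  simp only [thetaChar]
  rw [tsum_mul_tsum_of_summable_norm (summable_norm_thetaCharTerm a b hy)
    (summable_norm_thetaCharTerm a' b' hy),
    tsum_mul_tsum_of_summable_norm (summable_norm_thetaCharTerm _ _ hy2)
      (summable_norm_thetaCharTerm _ _ hy2),
    tsum_mul_tsum_of_summable_norm (summable_norm_thetaCharTerm _ _ hy2)
      (summable_norm_thetaCharTerm _ _ hy2), ← tsum_mul_left,
    ← rotatePairsEquiv.tsum_eq]
  refine (Summable.tsum_sum (key.comp_injective Sum.inl_injective)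
      (key.comp_injective Sum.inr_injective)).trans ?_
  congr 1
  all_goals
    refine tsum_congr fun p => ?_
    simp only [Function.comp_apply, rotatePairsEquiv_inl, rotatePairsEquiv_inr, thetaCharTerm,
      ← Complex.exp_add]
    congr 1
    push_cast
    ring

lemma thetaChar_zero_zero (y : ℝ) : thetaChar 0 0 y = theta3 y := by
  rw [thetaChar, theta3, Complex.ofReal_tsum]
  refine tsum_congr fun n => ?_
  simp [thetaCharTerm]

lemma exp_two_pi_quarter : Complex.exp (2 * π * (1 / 4 : ℝ) * Complex.I) = Complex.I := by
  refine Eq.trans ?_ Complex.exp_pi_div_two_mul_I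
  congr 1; push_cast; ring

lemma exp_two_pi_half : Complex.exp (2 * π * (1 / 2 : ℝ) * Complex.I) = -1 := by
  refine Eq.trans ?_ Complex.exp_pi_mul_I
  congr 1; push_cast; ring

lemma exp_neg_two_pi_mul (b : ℝ) : Complex.exp (-2 * π * b * Complex.I) =
    (Complex.exp (2 * π * b * Complex.I))⁻¹ := by
  rw [← Complex.exp_neg]
  congr 1; ring

lemma thetaChar_zero_neg_half (y : ℝ) : thetaChar 0 (-(1 / 2)) y = thetaChar 0 (1 / 2) y := by
  rw [← thetaChar_add_one_right]
  norm_num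

lemma thetaChar_half_half (y : ℝ) : thetaChar (1 / 2) (1 / 2) y = 0 := by
  have h₁ := thetaChar_add_one_left (-(1 / 2)) (1 / 2) y
  have h₂ := thetaChar_add_one_right (-(1 / 2)) (-(1 / 2)) y
  rw [thetaChar_neg, show (-(1 / 2) + 1 : ℝ) = 1 / 2 by norm_num] at h₂
  rw [exp_neg_two_pi_mul, exp_two_pi_half, h₂, show (-(1 / 2) + 1 : ℝ) = 1 / 2 by norm_num] at h₁
  linear_combination h₁ / 2

/-- Shifting the first characteristic by one when the second is zero. -/
lemma thetaChar_add_one_zero (a y : ℝ) : thetaChar (a + 1) 0 y = thetaChar a 0 y := by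
  simpa using thetaChar_add_one_left a 0 y

lemma theta3_sq {y : ℝ} (hy : 0 < y) : thetaChar 0 0 y ^ 2 =
    thetaChar 0 0 (2 * y) ^ 2 + thetaChar (1 / 2) 0 (2 * y) ^ 2 := by
  simpa [sq] using thetaChar_mul_thetaChar 0 0 0 0 hy

lemma theta4_sq {y : ℝ} (hy : 0 < y) : thetaChar 0 (1 / 2) y ^ 2 =
    thetaChar 0 0 (2 * y) ^ 2 - thetaChar (1 / 2) 0 (2 * y) ^ 2 := by
  have h := thetaChar_mul_thetaChar 0 (1 / 2) 0 (1 / 2) hy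
  rw [exp_two_pi_half, show (1 / 2 + 1 / 2 : ℝ) = 0 + 1 by norm_num, thetaChar_add_one_right,
    thetaChar_add_one_right] at h
  simp only [add_zero, zero_div, sub_self, zero_add] at h
  linear_combination h

lemma theta2_sq {y : ℝ} (hy : 0 < y) : thetaChar (1 / 2) 0 y ^ 2 =
    2 * (thetaChar 0 0 (2 * y) * thetaChar (1 / 2) 0 (2 * y)) := by
  have h := thetaChar_mul_thetaChar (1 / 2) 0 (1 / 2) 0 hy
  have h' := thetaChar_add_one_zero 0 (2 * y)
  norm_num at h h' ⊢
  rw [h'] at h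
  linear_combination h

lemma theta3_mul_theta4 {y : ℝ} (hy : 0 < y) : thetaChar 0 0 y * thetaChar 0 (1 / 2) y =
    thetaChar 0 (1 / 2) (2 * y) ^ 2 := by
  have h := thetaChar_mul_thetaChar 0 0 0 (1 / 2) hy
  simp only [add_zero, zero_div, sub_self, zero_add, zero_sub, thetaChar_half_half,
    thetaChar_zero_neg_half] at h
  linear_combination h

lemma theta2_mul_theta3 {y : ℝ} (hy : 0 < y) : thetaChar (1 / 2) 0 y * thetaChar 0 0 y =
    2 * thetaChar (1 / 4) 0 (2 * y) ^ 2 := by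
  have h := thetaChar_mul_thetaChar (1 / 2) 0 0 0 hy
  have h₁ := thetaChar_add_one_zero (-(1 / 4)) (2 * y)
  have h₂ := thetaChar_neg (1 / 4) 0 (2 * y)
  norm_num at h h₁ h₂ ⊢
  rw [h₁, h₂] at h
  linear_combination h

lemma theta2_mul_theta4 {y : ℝ} (hy : 0 < y) : thetaChar (1 / 2) 0 y * thetaChar 0 (1 / 2) y =
    2 * thetaChar (1 / 4) (1 / 2) (2 * y) ^ 2 := by
  have h := thetaChar_mul_thetaChar (1 / 2) 0 0 (1 / 2) hy
  have h₁ := thetaChar_add_one_left (-(1 / 4)) (1 / 2) (2 * y)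
  have h₂ := thetaChar_neg (1 / 4) (1 / 2) (2 * y)
  have h₃ := thetaChar_add_one_right (1 / 4) (-(1 / 2)) (2 * y)
  have h₄ := thetaChar_add_one_right (-(1 / 4)) (-(1 / 2)) (2 * y)
  have h₅ := thetaChar_add_one_right (3 / 4) (-(1 / 2)) (2 * y)
  rw [exp_neg_two_pi_mul, exp_two_pi_half] at h₁
  norm_num at h h₁ h₂ h₃ h₄ h₅ ⊢
  rw [← h₃, ← h₅, h₁, h₄, h₂] at h
  linear_combination h

lemma theta_zero_quarter_sq {y : ℝ} (hy : 0 < y) : thetaChar 0 (1 / 4) y ^ 2 =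
    thetaChar 0 0 (2 * y) * thetaChar 0 (1 / 2) (2 * y) := by
  have h := thetaChar_mul_thetaChar 0 (1 / 4) 0 (1 / 4) hy
  have h₁ := thetaChar_half_half (2 * y)
  norm_num at h h₁ ⊢
  rw [h₁] at h
  linear_combination h

lemma theta_half_quarter_sq {y : ℝ} (hy : 0 < y) : thetaChar (1 / 2) (1 / 4) y ^ 2 =
    -Complex.I * (thetaChar (1 / 2) 0 (2 * y) * thetaChar 0 (1 / 2) (2 * y)) := by
  have h := thetaChar_mul_thetaChar (1 / 2) (1 / 4) (1 / 2) (1 / 4) hy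
  have h₁ := thetaChar_half_half (2 * y)
  have h₂ := thetaChar_add_one_left 0 (1 / 2) (2 * y)
  rw [exp_neg_two_pi_mul, exp_two_pi_half] at h₂
  rw [exp_two_pi_quarter] at h
  norm_num at h h₁ h₂ ⊢
  rw [h₁, h₂] at h
  linear_combination h

lemma theta_quarter_quarter_sq {y : ℝ} (hy : 0 < y) : thetaChar (1 / 4) (1 / 4) y ^ 2 =
    thetaChar (1 / 4) (1 / 2) (2 * y) *
      (thetaChar 0 0 (2 * y) - Complex.I * thetaChar (1 / 2) 0 (2 * y)) := by
  have h := thetaChar_mul_thetaChar (1 / 4) (1 / 4) (1 / 4) (1 / 4) hy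
  have h₁ := thetaChar_add_one_left (-(1 / 4)) (1 / 2) (2 * y)
  have h₂ := thetaChar_neg (1 / 4) (1 / 2) (2 * y)
  have h₄ := thetaChar_add_one_right (-(1 / 4)) (-(1 / 2)) (2 * y)
  rw [exp_neg_two_pi_mul, exp_two_pi_half] at h₁
  rw [exp_two_pi_quarter] at h
  norm_num at h h₁ h₂ h₄ ⊢
  rw [h₁, h₄, h₂] at h
  linear_combination h

/-- Jacobi's quartic identity. -/
lemma theta3_pow_four {y : ℝ} (hy : 0 < y) : thetaChar 0 0 y ^ 4 =
    thetaChar (1 / 2) 0 y ^ 4 + thetaChar 0 (1 / 2) y ^ 4 := by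
  have h₂ := theta2_sq hy
  have h₃ := theta3_sq hy
  have h₄ := theta4_sq hy
  rw [show (4 : ℕ) = 2 * 2 by norm_num]
  simp only [pow_mul, h₂, h₃, h₄]
  ring

lemma theta_zero_quarter_pow_four {y : ℝ} (hy : 0 < y) : thetaChar 0 (1 / 4) y ^ 4 =
    thetaChar 0 0 y * thetaChar 0 (1 / 2) y *
      (thetaChar 0 0 y ^ 2 + thetaChar 0 (1 / 2) y ^ 2) / 2 := by
  rw [theta3_mul_theta4 hy, theta3_sq hy, theta4_sq hy, show (4 : ℕ) = 2 * 2 by norm_num, pow_mul,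
    theta_zero_quarter_sq hy]
  ring

lemma theta_half_quarter_pow_four {y : ℝ} (hy : 0 < y) : thetaChar (1 / 2) (1 / 4) y ^ 4 =
    -(thetaChar 0 0 y * thetaChar 0 (1 / 2) y *
      (thetaChar 0 0 y ^ 2 - thetaChar 0 (1 / 2) y ^ 2) / 2) := by
  rw [theta3_mul_theta4 hy, theta3_sq hy, theta4_sq hy, show (4 : ℕ) = 2 * 2 by norm_num, pow_mul,
    theta_half_quarter_sq hy, mul_pow, neg_sq, Complex.I_sq]
  ring

lemma theta_quarter_zero_pow_four {y : ℝ} (hy : 0 < y) : thetaChar (1 / 4) 0 y ^ 4 =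
    thetaChar 0 0 y * thetaChar (1 / 2) 0 y *
      (thetaChar 0 0 y ^ 2 + thetaChar (1 / 2) 0 y ^ 2) / 2 := by
  have hy2 : 0 < y / 2 := by positivity
  have h := theta2_mul_theta3 hy2
  have h₂ := theta2_sq hy2
  have h₃ := theta3_sq hy2
  rw [mul_div_cancel₀ y two_ne_zero] at h h₂ h₃
  linear_combination
    -(thetaChar (1 / 2) 0 (y / 2) * thetaChar 0 0 (y / 2) + 2 * thetaChar (1 / 4) 0 y ^ 2) / 4 * h
      + thetaChar 0 0 (y / 2) ^ 2 / 4 * h₂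
      + thetaChar 0 0 y * thetaChar (1 / 2) 0 y / 2 * h₃

lemma theta_quarter_half_pow_four {y : ℝ} (hy : 0 < y) : thetaChar (1 / 4) (1 / 2) y ^ 4 =
    thetaChar 0 0 y * thetaChar (1 / 2) 0 y *
      (thetaChar 0 0 y ^ 2 - thetaChar (1 / 2) 0 y ^ 2) / 2 := by
  have hy2 : 0 < y / 2 := by positivity
  have h := theta2_mul_theta4 hy2
  have h₂ := theta2_sq hy2
  have h₃ := theta4_sq hy2
  rw [mul_div_cancel₀ y two_ne_zero] at h h₂ h₃
  linear_combination
    -(thetaChar (1 / 2) 0 (y / 2) * thetaChar 0 (1 / 2) (y / 2) +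
        2 * thetaChar (1 / 4) (1 / 2) y ^ 2) / 4 * h
      + thetaChar 0 (1 / 2) (y / 2) ^ 2 / 4 * h₂
      + thetaChar 0 0 y * thetaChar (1 / 2) 0 y / 2 * h₃

lemma theta_quarter_quarter_pow_four {y : ℝ} (hy : 0 < y) : thetaChar (1 / 4) (1 / 4) y ^ 4 =
    thetaChar (1 / 2) 0 y * thetaChar 0 (1 / 2) y *
      (thetaChar 0 (1 / 2) y ^ 2 - Complex.I * thetaChar (1 / 2) 0 y ^ 2) / 2 := by
  rw [theta2_mul_theta4 hy, theta2_sq hy, theta4_sq hy, show (4 : ℕ) = 2 * 2 by norm_num, pow_mul,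
    theta_quarter_quarter_sq hy]
  linear_combination thetaChar (1 / 4) (1 / 2) (2 * y) ^ 2 * thetaChar (1 / 2) 0 (2 * y) ^ 2 *
    Complex.I_sq

lemma summable_norm_pi_prod {f : ℤ → ℂ} (hf : Summable fun n => ‖f n‖) (d : ℕ) :
    Summable fun v : Fin d → ℤ => ‖∏ i, f (v i)‖ := by
  induction d with
  | zero => exact Summable.of_finite
  | succ d ih =>
    rw [← (Fin.consEquiv fun _ : Fin (d + 1) => ℤ).summable_iff]
    refine (hf.mul_norm ih).congr fun p => ?_
    simp [Fin.consEquiv, Fin.prod_univ_succ]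

lemma tsum_pow_eq_tsum_pi_prod {f : ℤ → ℂ} (hf : Summable fun n => ‖f n‖) (d : ℕ) :
    (∑' n, f n) ^ d = ∑' v : Fin d → ℤ, ∏ i, f (v i) := by
  induction d with
  | zero => simp
  | succ d ih =>
    rw [pow_succ', ih, tsum_mul_tsum_of_summable_norm hf (summable_norm_pi_prod hf d),
      ← (Fin.consEquiv fun _ : Fin (d + 1) => ℤ).tsum_eq]
    exact tsum_congr fun p => by simp [Fin.consEquiv, Fin.prod_univ_succ]

lemma prod_thetaCharTerm (k l : ℕ) (y : ℝ) (v : Fin 16 → ℤ) :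
    ∏ i, thetaCharTerm (k / 4) (l / 4) y (v i) =
      (Complex.I ^ (∑ i, v i)) ^ l * (Real.exp (-π * y * ∑ i, ((v i : ℝ) + k / 4) ^ 2) : ℂ) := by
  simp only [thetaCharTerm]
  rw [← Complex.exp_sum, Finset.sum_sub_distrib, Complex.exp_sub, div_eq_mul_inv,
    ← Complex.exp_neg]
  congr 1
  · conv_rhs => rw [← Complex.exp_pi_div_two_mul_I, ← Complex.exp_int_mul, ← Complex.exp_nat_mul]
    congr 1
    push_cast
    simp only [Finset.sum_mul, Finset.mul_sum]
    exact Finset.sum_congr rfl fun i _ => by ring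
  · push_cast
    simp only [← Finset.mul_sum, neg_mul]

lemma sum_I_zpow_pow (N : ℤ) :
    ∑ l : Fin 4, (Complex.I ^ N) ^ (l : ℕ) = if 4 ∣ N then 4 else 0 := by
  have hN : Complex.I ^ N = Complex.I ^ (N % 4) := by
    conv_lhs => rw [← Int.emod_add_mul_ediv N 4, zpow_add₀ Complex.I_ne_zero, zpow_mul]
    have : Complex.I ^ (4 : ℤ) = 1 := mod_cast Complex.I_pow_four
    rw [this, one_zpow, mul_one]
  rw [hN, Fin.sum_univ_four]
  have h₀ := Int.emod_nonneg N (by norm_num : (4 : ℤ) ≠ 0)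
  have h₄ := Int.emod_lt_of_pos N (by norm_num : (0 : ℤ) < 4)
  simp only [Int.dvd_iff_emod_eq_zero]
  have h₃ : Complex.I ^ 3 = -Complex.I := Complex.I_pow_three
  interval_cases h : N % 4
  · norm_num
  · norm_num [h₃]
  · norm_num [zpow_ofNat]
  · norm_num [zpow_ofNat, h₃]
    linear_combination -h₃

/-- Pairs `(k, v)` indexing the vectors `v + k/4` of the lattice `A₁₅⁺ ⊕ ℤ`. -/
def shiftedPairs : Set (Fin 4 × (Fin 16 → ℤ)) := {z | 4 ∣ ∑ i, z.2 i}

/-- The Gaussian weight of the vector `v + k/4`. -/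
noncomputable def shiftedWeight (y : ℝ) (z : Fin 4 × (Fin 16 → ℤ)) : ℝ :=
  Real.exp (-π * y * ∑ i, ((z.2 i : ℝ) + (z.1 : ℕ) / 4) ^ 2)

lemma summable_shiftedWeight {y : ℝ} (hy : 0 < y) : Summable (shiftedWeight y) := by
  refine (summable_prod_of_nonneg fun z => (Real.exp_pos _).le).2 ⟨fun k => ?_, Summable.of_finite⟩
  refine (summable_norm_pi_prod (summable_norm_thetaCharTerm ((k : ℕ) / 4) ((0 : ℕ) / 4) hy)
    16).congr fun v => ?_
  rw [prod_thetaCharTerm, pow_zero, one_mul, Complex.norm_real, norm_of_nonneg (Real.exp_pos _).le]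

lemma sum_thetaChar_pow {y : ℝ} (hy : 0 < y) :
    ∑ k : Fin 4, ∑ l : Fin 4, thetaChar ((k : ℕ) / 4) ((l : ℕ) / 4) y ^ 16 =
      4 * ((∑' z : shiftedPairs, shiftedWeight y z : ℝ) : ℂ) := by
  have hsum := summable_shiftedWeight hy
  have hind : Summable (shiftedPairs.indicator (shiftedWeight y)) := hsum.indicator _
  have hind' : Summable fun z => ((shiftedPairs.indicator (shiftedWeight y) z : ℝ) : ℂ) :=
    Complex.summable_ofReal.2 hind
  rw [tsum_subtype, Complex.ofReal_tsum, hind'.tsum_prod, tsum_fintype, Finset.mul_sum]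
  refine Finset.sum_congr rfl fun k _ => ?_
  simp only [thetaChar]
  rw [Finset.sum_congr rfl fun (l : Fin 4) _ =>
      tsum_pow_eq_tsum_pi_prod (summable_norm_thetaCharTerm ((k : ℕ) / 4) ((l : ℕ) / 4) hy) 16,
    ← Summable.tsum_finsetSum fun (l : Fin 4) _ => (summable_norm_pi_prod
      (summable_norm_thetaCharTerm ((k : ℕ) / 4) ((l : ℕ) / 4) hy) 16).of_norm, ← tsum_mul_left]
  refine tsum_congr fun v => ?_
  simp only [prod_thetaCharTerm]
  rw [← Finset.sum_mul, sum_I_zpow_pow]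
  by_cases h : 4 ∣ ∑ i, v i
  · rw [if_pos h, Set.indicator_of_mem (show (k, v) ∈ shiftedPairs from h)]
    rfl
  · rw [if_neg h, Set.indicator_of_notMem (show (k, v) ∉ shiftedPairs from h)]
    simp

/-- The integer by which the coordinate sum of `v + k/4` exceeds zero, divided by four. -/
def shiftedHeight (z : Fin 4 × (Fin 16 → ℤ)) : ℤ := (∑ i, z.2 i) / 4 + (z.1 : ℕ)

lemma sum_eq_of_mem_shiftedPairs {z : Fin 4 × (Fin 16 → ℤ)} (hz : z ∈ shiftedPairs) :
    ∑ i, (z.2 i : ℝ) = 4 * (shiftedHeight z - (z.1 : ℕ)) := by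
  obtain ⟨c, hc⟩ : 4 ∣ ∑ i, z.2 i := hz
  have h : ∑ i, z.2 i = 4 * (shiftedHeight z - (z.1 : ℕ)) := by
    rw [shiftedHeight]; omega
  exact_mod_cast h

/-- The orthogonal projection of `v + k/4` to the hyperplane of vectors with coordinate sum zero. -/
noncomputable def shiftedProj (z : Fin 4 × (Fin 16 → ℤ)) : EuclideanSpace ℝ (Fin 16) :=
  WithLp.toLp 2 fun i => (z.2 i : ℝ) + (z.1 : ℕ) / 4 - shiftedHeight z / 4

lemma shiftedProj_apply (z : Fin 4 × (Fin 16 → ℤ)) (i : Fin 16) :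
    shiftedProj z i = (z.2 i : ℝ) + (z.1 : ℕ) / 4 - shiftedHeight z / 4 := rfl

lemma sum_shiftedProj {z : Fin 4 × (Fin 16 → ℤ)} (hz : z ∈ shiftedPairs) :
    ∑ i, shiftedProj z i = 0 := by
  simp only [shiftedProj_apply, Finset.sum_sub_distrib, Finset.sum_add_distrib,
    sum_eq_of_mem_shiftedPairs hz, Finset.sum_const, Finset.card_univ, Fintype.card_fin]
  simp only [nsmul_eq_mul]
  push_cast
  ring

lemma exists_glueA15_eq (k : ℤ) (i : Fin 16) : ∃ m : ℤ, (k : ℝ) * glueA15 i = k / 4 + m := by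
  rw [glueA15]
  split_ifs
  · exact ⟨0, by push_cast; ring⟩
  · exact ⟨-k, by push_cast; ring⟩

lemma exists_fin_four (k : ℤ) : ∃ (r : Fin 4) (q : ℤ), k = (r : ℕ) + 4 * q :=
  ⟨⟨(k % 4).toNat, by omega⟩, k / 4, by simp only; omega⟩

lemma shiftedProj_mem {z : Fin 4 × (Fin 16 → ℤ)} (hz : z ∈ shiftedPairs) :
    shiftedProj z ∈ A15plus := by
  refine ⟨sum_shiftedProj hz, ?_⟩
  obtain ⟨r, q, h⟩ := exists_fin_four ((z.1 : ℕ) - shiftedHeight z)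
  refine ⟨r, fun i => ?_⟩
  obtain ⟨m, hm⟩ := exists_glueA15_eq ((r : ℕ) : ℤ) i
  rw [Int.cast_natCast] at hm
  refine ⟨z.2 i + q - m, ?_⟩
  have h' : ((z.1 : ℕ) : ℝ) - shiftedHeight z = (r : ℕ) + 4 * q := by exact_mod_cast h
  rw [shiftedProj_apply, hm]
  push_cast
  linear_combination h' / 4

lemma shiftedWeight_eq (y : ℝ) {z : Fin 4 × (Fin 16 → ℤ)} (hz : z ∈ shiftedPairs) :
    shiftedWeight y z = Real.exp (-π * y * ‖shiftedProj z‖ ^ 2) *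
      Real.exp (-π * y * (shiftedHeight z : ℝ) ^ 2) := by
  rw [shiftedWeight, ← Real.exp_add, ← mul_add, EuclideanSpace.real_norm_sq_eq]
  congr 2
  have h : ∀ i, ((z.2 i : ℝ) + (z.1 : ℕ) / 4) ^ 2 = shiftedProj z i ^ 2 +
      shiftedHeight z / 2 * shiftedProj z i + (shiftedHeight z : ℝ) ^ 2 / 16 := fun i => by
    rw [shiftedProj_apply]; ring
  simp only [h, Finset.sum_add_distrib, ← Finset.mul_sum, sum_shiftedProj hz]
  simp
  ring

/-- The lattice of vectors `v + k/4` splits as `A₁₅⁺ ⊕ ℤ`. -/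
noncomputable def shiftedPairsEquiv : shiftedPairs ≃ A15plus × ℤ :=
  Equiv.ofBijective (fun z => (⟨shiftedProj z, shiftedProj_mem z.2⟩, shiftedHeight z)) <| by
    constructor
    · rintro ⟨⟨k, v⟩, hz⟩ ⟨⟨l, w⟩, hw⟩ h
      simp only [Prod.mk.injEq, Subtype.mk.injEq] at h ⊢
      obtain ⟨hp, hh⟩ := h
      have hi : ∀ i, 4 * v i + (k : ℕ) = 4 * w i + (l : ℕ) := fun i => by
        have := congrArg (fun x : EuclideanSpace ℝ (Fin 16) => x i) hp
        simp only [shiftedProj_apply, hh] at this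
        have h4 : (4 * v i + (k : ℕ) : ℝ) = 4 * w i + (l : ℕ) := by linear_combination 4 * this
        exact_mod_cast h4
      have hk := k.isLt
      have hl := l.isLt
      refine ⟨Fin.ext ?_, funext fun i => ?_⟩
      · have := hi 0
        omega
      · have := hi i
        omega
    · rintro ⟨⟨x, hx₀, k, hx⟩, c⟩
      have hx' := hx
      choose m hm using hx'
      choose g hg using exists_glueA15_eq ((k : ℕ) : ℤ)
      obtain ⟨r, q, h⟩ := exists_fin_four ((k : ℕ) + c)
      have h' : ((k : ℕ) : ℝ) + c = (r : ℕ) + 4 * q := by exact_mod_cast h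
      let v : Fin 16 → ℤ := fun i => m i + g i + q
      have hv : ∀ i, (v i : ℝ) = x i + c / 4 - (r : ℕ) / 4 := fun i => by
        have h₁ := hg i
        rw [Int.cast_natCast] at h₁
        push_cast [v]
        linear_combination -hm i - h₁ - h' / 4
      have hsum : ∑ i, v i = 4 * (c - (r : ℕ)) := by
        have : ∑ i, (v i : ℝ) = 4 * (c - (r : ℕ)) := by
          simp only [hv, Finset.sum_sub_distrib, Finset.sum_add_distrib, hx₀, Finset.sum_const,
            Finset.card_univ, Fintype.card_fin, nsmul_eq_mul]
          push_cast
          ring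
        exact_mod_cast this
      have hz : (r, v) ∈ shiftedPairs := ⟨_, hsum⟩
      have hc : shiftedHeight (r, v) = c := by
        simp only [shiftedHeight, hsum]
        omega
      refine ⟨⟨(r, v), hz⟩, ?_⟩
      simp only [Prod.mk.injEq]
      refine ⟨Subtype.ext ?_, hc⟩
      ext i
      rw [shiftedProj_apply, hc, hv]
      ring

lemma summable_theta3 {y : ℝ} (hy : 0 < y) :
    Summable fun n : ℤ => Real.exp (-π * y * (n : ℝ) ^ 2) := by
  refine (summable_norm_thetaCharTerm 0 0 hy).congr fun n => ?_
  rw [thetaCharTerm, Complex.norm_exp, ← Complex.ofReal_re (-π * y * (n : ℝ) ^ 2)]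
  congr 2
  push_cast
  ring

lemma tsum_shiftedWeight {y : ℝ} (hy : 0 < y) :
    ∑' z : shiftedPairs, shiftedWeight y z =
      (∑' x : A15plus, Real.exp (-π * y * ‖(x : EuclideanSpace ℝ (Fin 16))‖ ^ 2)) * theta3 y := by
  let F : A15plus × ℤ → ℝ := fun p =>
    Real.exp (-π * y * ‖(p.1 : EuclideanSpace ℝ (Fin 16))‖ ^ 2) *
      Real.exp (-π * y * (p.2 : ℝ) ^ 2)
  have hF : ∀ z : shiftedPairs, shiftedWeight y z = F (shiftedPairsEquiv z) := fun z =>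
    shiftedWeight_eq y z.2
  have hs : Summable F := by
    rw [← shiftedPairsEquiv.summable_iff]
    exact ((summable_shiftedWeight hy).subtype _).congr hF
  have hs₀ : Summable fun x : A15plus =>
      Real.exp (-π * y * ‖(x : EuclideanSpace ℝ (Fin 16))‖ ^ 2) := by
    refine (hs.comp_injective (Prod.mk_left_injective (0 : ℤ))).congr fun x => ?_
    simp [F]
  rw [theta3, hs₀.tsum_mul_tsum (summable_theta3 hy) hs, ← shiftedPairsEquiv.tsum_eq]
  exact tsum_congr hF

lemma thetaChar_three_quarters (b y : ℝ) : thetaChar (3 / 4) b y =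
    (Complex.exp (2 * π * b * Complex.I))⁻¹ * thetaChar (1 / 4) (-b) y := by
  rw [← exp_neg_two_pi_mul, ← thetaChar_neg (1 / 4) (-b), neg_neg, ← thetaChar_add_one_left]
  norm_num

lemma ofReal_re_thetaChar_half_zero (y : ℝ) :
    ((thetaChar (1 / 2) 0 y).re : ℂ) = thetaChar (1 / 2) 0 y := by
  rw [← Complex.conj_eq_iff_re, conj_thetaChar, neg_zero]

lemma ofReal_re_thetaChar_zero_half (y : ℝ) :
    ((thetaChar 0 (1 / 2) y).re : ℂ) = thetaChar 0 (1 / 2) y := by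
  rw [← Complex.conj_eq_iff_re, conj_thetaChar, thetaChar_zero_neg_half]

lemma thetaChar_three_quarters_right (a y : ℝ) :
    thetaChar a (3 / 4) y = thetaChar a (-(1 / 4)) y := by
  rw [← thetaChar_add_one_right a (-(1 / 4))]
  norm_num

lemma thetaChar_half_neg_quarter (y : ℝ) :
    thetaChar (1 / 2) (-(1 / 4)) y = Complex.I * thetaChar (1 / 2) (1 / 4) y := by
  have h := thetaChar_add_one_left (-(1 / 2)) (1 / 4) y
  rw [exp_neg_two_pi_mul, exp_two_pi_quarter, show (-(1 / 2) + 1 : ℝ) = 1 / 2 by norm_num] at h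
  rw [← thetaChar_neg, neg_neg, h, mul_inv_cancel_left₀ Complex.I_ne_zero]

lemma thetaChar_zero_neg_quarter (y : ℝ) :
    thetaChar 0 (-(1 / 4)) y = thetaChar 0 (1 / 4) y := by
  rw [← thetaChar_neg, neg_neg, neg_zero]

lemma thetaChar_quarter_neg_half (y : ℝ) :
    thetaChar (1 / 4) (-(1 / 2)) y = thetaChar (1 / 4) (1 / 2) y := by
  rw [← thetaChar_add_one_right]
  norm_num

lemma theta_quarter_neg_quarter_pow_four {y : ℝ} (hy : 0 < y) :
    thetaChar (1 / 4) (-(1 / 4)) y ^ 4 = thetaChar (1 / 2) 0 y * thetaChar 0 (1 / 2) y *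
      (thetaChar 0 (1 / 2) y ^ 2 + Complex.I * thetaChar (1 / 2) 0 y ^ 2) / 2 := by
  have h := congrArg (starRingEnd ℂ) (theta_quarter_quarter_pow_four hy)
  simp only [map_pow, map_mul, map_div₀, map_sub, conj_thetaChar, Complex.conj_I, neg_zero,
    thetaChar_zero_neg_half, map_ofNat] at h
  rw [h]
  ring

lemma thetaChar_three_quarters_pow (l : ℤ) (y : ℝ) :
    thetaChar (3 / 4) (l / 4) y ^ 16 = thetaChar (1 / 4) (-(l / 4)) y ^ 16 := by
  have h : Complex.exp (2 * π * (l / 4 : ℝ) * Complex.I) ^ 16 = 1 := by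
    rw [← Complex.exp_nat_mul, Complex.exp_eq_one_iff]
    exact ⟨4 * l, by push_cast; ring⟩
  rw [thetaChar_three_quarters, mul_pow, inv_pow, h, inv_one, one_mul]

lemma sum_thetaChar_pow_eq {y : ℝ} (hy : 0 < y) :
    ∑ k : Fin 4, ∑ l : Fin 4, thetaChar ((k : ℕ) / 4) ((l : ℕ) / 4) y ^ 16 =
      thetaChar 0 0 y ^ 8 * (thetaChar 0 0 y ^ 8 +
        15 * (thetaChar (1 / 2) 0 y ^ 8 + thetaChar 0 (1 / 2) y ^ 8)) / 4 := by
  have h₀ := thetaChar_three_quarters_pow 0 y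
  have h₁ := thetaChar_three_quarters_pow 1 y
  have h₂ := thetaChar_three_quarters_pow 2 y
  simp only [Int.cast_zero, Int.cast_one, Int.cast_ofNat, zero_div, neg_zero,
    show (2 / 4 : ℝ) = 1 / 2 by norm_num] at h₀ h₁ h₂
  have h₃ : thetaChar (3 / 4) (-(1 / 4)) y ^ 16 = thetaChar (1 / 4) (1 / 4) y ^ 16 := by
    simpa [neg_div] using thetaChar_three_quarters_pow (-1) y
  have hI : Complex.I ^ 16 = 1 := by
    rw [show 16 = 4 * 4 by norm_num, pow_mul, Complex.I_pow_four, one_pow]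
  have h16 : ∀ z : ℂ, z ^ 16 = (z ^ 4) ^ 4 := fun z => by rw [← pow_mul]
  simp only [Fin.sum_univ_four, Fin.val_zero, Fin.val_one, Fin.val_two,
    show ((3 : Fin 4) : ℕ) = 3 from rfl, Nat.cast_zero, Nat.cast_one, Nat.cast_ofNat, zero_div,
    show (2 / 4 : ℝ) = 1 / 2 by norm_num, h₀, h₁, h₂, h₃, thetaChar_three_quarters_right,
    thetaChar_half_neg_quarter, thetaChar_zero_neg_quarter, thetaChar_quarter_neg_half,
    thetaChar_half_half, mul_pow, hI, one_mul]
  rw [h16 (thetaChar 0 (1 / 4) y), h16 (thetaChar (1 / 2) (1 / 4) y), h16 (thetaChar (1 / 4) 0 y),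
    h16 (thetaChar (1 / 4) (1 / 2) y), h16 (thetaChar (1 / 4) (1 / 4) y),
    h16 (thetaChar (1 / 4) (-(1 / 4)) y), theta_zero_quarter_pow_four hy,
    theta_half_quarter_pow_four hy, theta_quarter_zero_pow_four hy, theta_quarter_half_pow_four hy,
    theta_quarter_quarter_pow_four hy, theta_quarter_neg_quarter_pow_four hy]
  have hJ := theta3_pow_four hy
  generalize thetaChar 0 0 y = A at *
  generalize thetaChar (1 / 2) 0 y = B at *
  generalize thetaChar 0 (1 / 2) y = C at *
  have hB : (C ^ 2 - Complex.I * B ^ 2) ^ 4 + (C ^ 2 + Complex.I * B ^ 2) ^ 4 =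
      2 * (C ^ 8 - 6 * C ^ 4 * B ^ 4 + B ^ 8) := by
    linear_combination 2 * B ^ 4 * (6 * C ^ 4 + B ^ 4 * (Complex.I ^ 2 - 1)) * Complex.I_sq
  linear_combination B ^ 4 * C ^ 4 / 8 * hB + (3 * A ^ 12 + 4 * (B ^ 4 + C ^ 4) * A ^ 8 +
    (8 * B ^ 4 * C ^ 4 - 5 * B ^ 8 - 5 * C ^ 8) * A ^ 4 - 4 * B ^ 12 - 4 * C ^ 12 +
    3 * B ^ 8 * C ^ 4 + 3 * B ^ 4 * C ^ 8) / 4 * hJ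

lemma thetaChar_half_zero_one : thetaChar (1 / 2) 0 1 = thetaChar 0 (1 / 2) 1 := by
  have h := jacobiTheta₂_functional_equation (1 / 2) Complex.I
  rw [thetaChar_eq_jacobiTheta₂, thetaChar_eq_jacobiTheta₂ 0]
  have hI : (-Complex.I * Complex.I) = 1 := by simp
  have h₁ : (1 / 2 : ℂ) / Complex.I = -(Complex.I * (1 / 2)) := by
    rw [div_eq_mul_inv, Complex.inv_I]; ring
  have h₂ : -1 / Complex.I = Complex.I := by
    rw [div_eq_mul_inv, Complex.inv_I]; ring
  rw [hI, h₁, h₂, jacobiTheta₂_neg_left, Complex.one_cpow] at h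
  have h₃ : -π * Complex.I * (1 / 2) ^ 2 / Complex.I = -π * (1 / 2) ^ 2 := by
    field_simp
  rw [h₃] at h
  push_cast
  simp only [zero_add, mul_one, add_zero, ne_eq, OfNat.ofNat_ne_zero, not_false_eq_true, zero_pow,
    mul_zero, Complex.exp_zero, one_mul, div_one] at h ⊢
  rw [h]

lemma theta3_pos {y : ℝ} (hy : 0 < y) : 0 < theta3 y :=
  (summable_theta3 hy).tsum_pos (fun _ => (Real.exp_pos _).le) 0 (Real.exp_pos _)

lemma tsum_A15plus {y : ℝ} (hy : 0 < y) :
    ∑' x : A15plus, Real.exp (-π * y * ‖(x : EuclideanSpace ℝ (Fin 16))‖ ^ 2) =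
      theta3 y ^ 7 * (theta3 y ^ 8 + 15 * ((thetaChar (1 / 2) 0 y).re ^ 8 +
        (thetaChar 0 (1 / 2) y).re ^ 8)) / 16 := by
  have h := (sum_thetaChar_pow hy).symm.trans (sum_thetaChar_pow_eq hy)
  rw [tsum_shiftedWeight hy, thetaChar_zero_zero, ← ofReal_re_thetaChar_half_zero,
    ← ofReal_re_thetaChar_zero_half] at h
  norm_cast at h
  refine mul_right_cancel₀ (theta3_pos hy).ne' ?_
  linear_combination h / 4

lemma theta3_pow_four_real {y : ℝ} (hy : 0 < y) : theta3 y ^ 4 =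
    (thetaChar (1 / 2) 0 y).re ^ 4 + (thetaChar 0 (1 / 2) y).re ^ 4 := by
  have h := theta3_pow_four hy
  rw [thetaChar_zero_zero, ← ofReal_re_thetaChar_half_zero, ← ofReal_re_thetaChar_zero_half] at h
  exact_mod_cast h

/-- Secrecy gain of A₁₅⁺: for every y > 0 the secrecy function
θ₃(y)¹⁵ / Θ_{A₁₅⁺}(iy) is at most 32/17, with equality at y = 1; in particular
the secrecy gain of A₁₅⁺ is 32/17, achieved at τ = i. -/
theorem secrecy_gain_A15plus :
    (∀ y : ℝ, 0 < y →
      theta3 y ^ 15 / (∑' x : A15plus, Real.exp (-π * y * ‖(x : EuclideanSpace ℝ (Fin 16))‖^2))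
        ≤ 32/17) ∧
    theta3 1 ^ 15 / (∑' x : A15plus, Real.exp (-π * 1 * ‖(x : EuclideanSpace ℝ (Fin 16))‖^2))
      = 32/17 := by
  refine ⟨fun y hy => ?_, ?_⟩
  · have hA := theta3_pos hy
    have hJ := theta3_pow_four_real hy
    rw [tsum_A15plus hy]
    have h8 : theta3 y ^ 8 ≤
        2 * ((thetaChar (1 / 2) 0 y).re ^ 8 + (thetaChar 0 (1 / 2) y).re ^ 8) := by
      rw [show 8 = 4 * 2 by norm_num, pow_mul, hJ, pow_mul, pow_mul]
      exact add_sq_le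
    rw [div_le_div_iff₀ (by positivity) (by norm_num)]
    have := mul_le_mul_of_nonneg_left h8 (pow_pos hA 7).le
    linarith
  · have hA := theta3_pos one_pos
    have hJ := theta3_pow_four_real one_pos
    rw [tsum_A15plus one_pos]
    rw [thetaChar_half_zero_one] at hJ ⊢
    have h8 : theta3 1 ^ 8 = 4 * (thetaChar 0 (1 / 2) 1).re ^ 8 := by
      linear_combination (theta3 1 ^ 4 + 2 * (thetaChar 0 (1 / 2) 1).re ^ 4) * hJ
    rw [div_eq_div_iff (by positivity) (by norm_num)]
    linear_combination 15 * theta3 1 ^ 7 * h8
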